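/- Let (Q,·,n) be a quaternion algebra (a four-dimensional Hurwitz algebra) over a field k with a nontrivial grading Q = ⊕_{g∈G} Q_g by a group G (Q_1 ≠ Q, where Q_1 is the identity component). Then one of the following holds: (1) the support is {1, g} for an element g of order 2, Q_1 is a two-dimensional composition subalgebra of Q, and Q_g = (Q_1)^⊥ with respect to the polar form; (2) the characteristic of k is ≠ 2, the support is a subgroup {1, g, h, gh} of G isomorphic to Z/2 × Z/2, Q_1 = k·1, and there are elements x, y ∈ Q with n(x) ≠ 0 ≠ n(y), n(1, x) = 0, n(1, y) = n(x, y) = 0 such that Q_g = kx, Q_h = ky, and Q_{gh} = k(x·y); or (3) the support is {1, g, g⁻¹} with g ≠ g⁻¹, dim Q_1 = 2, dim Q_g = dim Q_{g⁻¹} = 1, and there is an algebra isomorphism of Q onto the 2×2 matrix algebra Mat₂(k) carrying Q_1 to the diagonal matrices, Q_g to the strictly upper triangular matrices, and Q_{g⁻¹} to the strictly lower triangular matrices. -/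

import Mathlib

open QuadraticMap

namespace HurwitzGrading

section Norm

variable {k : Type*} [Field k] {Q : Type*} [AddCommGroup Q] [Module k Q]
  {mul : Q →ₗ[k] Q →ₗ[k] Q} {n : QuadraticForm k Q}

theorem polar_mul_mul_left (hcomp : ∀ x y : Q, n (mul x y) = n x * n y) (x y z : Q) :
    polar n (mul x y) (mul x z) = n x * polar n y z := by
  simp only [polar, ← map_add, hcomp]
  ring

theorem polar_mul_mul_add (hcomp : ∀ x y : Q, n (mul x y) = n x * n y) (x y z w : Q) :
    polar n (mul x y) (mul z w) + polar n (mul z y) (mul x w) = polar n x z * polar n y w := by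
  have h := polar_mul_mul_left hcomp (x + z) y w
  have hx := polar_mul_mul_left hcomp x y w
  have hz := polar_mul_mul_left hcomp z y w
  simp only [map_add, LinearMap.add_apply, polar_add_left, polar_add_right] at h
  rw [QuadraticMap.map_add n x z] at h
  linear_combination h - hx - hz

theorem eq_of_polar_eq (hnondeg : ∀ x : Q, (∀ y : Q, polar n x y = 0) → x = 0) {x y : Q}
    (h : ∀ z, polar n x z = polar n y z) : x = y :=
  sub_eq_zero.1 <| hnondeg _ fun z => by rw [polar_sub_left, h, sub_self]

variable (hnondeg : ∀ x : Q, (∀ y : Q, polar n x y = 0) → x = 0)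
  (hcomp : ∀ x y : Q, n (mul x y) = n x * n y) {e : Q}
  (hle : ∀ x : Q, mul e x = x) (hre : ∀ x : Q, mul x e = x)

include hnondeg hcomp hle in
theorem mul_mul_self_left (x y : Q) :
    mul x (mul x y) = polar n x e • mul x y - n x • y := by
  refine eq_of_polar_eq hnondeg fun z => ?_
  have h := polar_mul_mul_add hcomp x (mul x y) e z
  rw [hle, hle, polar_mul_mul_left hcomp] at h
  simp only [polar_sub_left, polar_smul_left, smul_eq_mul]
  linear_combination h

include hcomp in
theorem polar_mul_mul_right (x y z : Q) :
    polar n (mul x y) (mul z y) = polar n x z * n y := by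
  simp only [polar, ← map_add, ← LinearMap.add_apply, hcomp]
  ring

include hnondeg hcomp hre in
theorem mul_mul_self_right (x y : Q) :
    mul (mul y x) x = polar n x e • mul y x - n x • y := by
  refine eq_of_polar_eq hnondeg fun z => ?_
  have h := polar_mul_mul_add hcomp (mul y x) x z e
  rw [hre, hre, polar_comm n (mul z x), polar_mul_mul_right hcomp] at h
  simp only [polar_sub_left, polar_smul_left, smul_eq_mul]
  linear_combination h

include hnondeg hcomp hle hre in
theorem mul_self_eq (x : Q) : mul x x = polar n x e • x - n x • e := by
  simpa only [hre] using mul_mul_self_left hnondeg hcomp hle x e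

include hnondeg hcomp hle hre in
theorem polar_smul_one_eq (x y : Q) :
    polar n x y • e = polar n x e • y + polar n y e • x - (mul x y + mul y x) := by
  have h := mul_self_eq hnondeg hcomp hle hre (x + y)
  have hx := mul_self_eq hnondeg hcomp hle hre x
  have hy := mul_self_eq hnondeg hcomp hle hre y
  simp only [map_add, LinearMap.add_apply, polar_add_left, hx, hy, QuadraticMap.map_add n x y] at h
  linear_combination (norm := module) (1 : k) • h

include hnondeg hcomp hle in
theorem map_one_eq_one [Nontrivial Q] : n e = 1 := by
  have hne : n e ≠ 0 := fun h0 => by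
    have hz : ∀ x, n x = 0 := fun x => by rw [← hle x, hcomp, h0, zero_mul]
    obtain ⟨x, hx⟩ := exists_ne (0 : Q)
    exact hx (hnondeg x fun y => by simp [polar, hz])
  have h := hcomp e e
  rw [hle] at h
  exact mul_left_cancel₀ hne (by rw [← h, mul_one])

include hnondeg hcomp hle in
theorem mul_left_injective_of_map_ne_zero {x : Q} (hx : n x ≠ 0) :
    Function.Injective (mul x) := by
  refine (injective_iff_map_eq_zero _).2 fun y hy => ?_
  have h := mul_mul_self_left hnondeg hcomp hle x y
  rw [hy, map_zero, smul_zero, zero_sub, eq_comm, neg_eq_zero] at h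
  exact (smul_eq_zero.1 h).resolve_left hx

end Norm

section Indep

variable {k : Type*} [Field k] {Q : Type*} [AddCommGroup Q] [Module k Q]
  {ι : Type*} {A : ι → Submodule k Q}

theorem eq_zero_of_eq_add (hA : iSupIndep A) {g a b : ι} (ha : a ≠ g) (hb : b ≠ g) {x y z : Q}
    (hx : x ∈ A g) (hy : y ∈ A a) (hz : z ∈ A b) (h : x = y + z) : x = 0 := by
  refine Submodule.disjoint_def.1 (hA g) x hx ?_
  rw [h]
  exact add_mem (Submodule.mem_iSup_of_mem a (Submodule.mem_iSup_of_mem ha hy))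
    (Submodule.mem_iSup_of_mem b (Submodule.mem_iSup_of_mem hb hz))

theorem finrank_sup_eq_sum [FiniteDimensional k Q] (hA : iSupIndep A) (s : Finset ι) :
    Module.finrank k (s.sup A : Submodule k Q) = ∑ i ∈ s, Module.finrank k (A i) := by
  classical
  induction s using Finset.induction_on with
  | empty => simp
  | insert a s ha ih =>
    have hdisj : Disjoint (A a) (s.sup A) := (hA a).mono_right (Finset.sup_le fun i hi =>
      le_iSup₂_of_le i (by rintro rfl; exact ha hi) le_rfl)
    have h := Submodule.finrank_sup_add_finrank_inf_eq (A a) (s.sup A)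
    rwa [hdisj.eq_bot, finrank_bot, add_zero, ih, ← Finset.sup_insert,
      ← Finset.sum_insert (f := fun i => Module.finrank k (A i)) ha] at h

theorem sum_finrank_le [FiniteDimensional k Q] (hA : iSupIndep A) (s : Finset ι) :
    ∑ i ∈ s, Module.finrank k (A i) ≤ Module.finrank k Q :=
  finrank_sup_eq_sum hA s ▸ Submodule.finrank_le _

theorem eq_bot_of_sum_finrank_eq [FiniteDimensional k Q] (hA : iSupIndep A) {s : Finset ι}
    (hs : ∑ i ∈ s, Module.finrank k (A i) = Module.finrank k Q) {i : ι} (hi : i ∉ s) :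
    A i = ⊥ := by
  classical
  have h := sum_finrank_le hA (insert i s)
  rw [Finset.sum_insert hi, hs] at h
  exact Submodule.finrank_eq_zero.1 (by omega)

theorem support_eq_of_sum_finrank_eq [FiniteDimensional k Q] (hA : iSupIndep A) {s : Finset ι}
    (hs : ∑ i ∈ s, Module.finrank k (A i) = Module.finrank k Q) (h0 : ∀ i ∈ s, A i ≠ ⊥) :
    {i | A i ≠ ⊥} = (s : Set ι) := by
  ext i
  refine ⟨fun hi => ?_, h0 i⟩
  by_contra h
  exact hi (eq_bot_of_sum_finrank_eq hA hs h)

theorem eq_span_of_finrank_eq_one {p : Submodule k Q} (hp : Module.finrank k p = 1) {x : Q}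
    (hx : x ∈ p) (h0 : x ≠ 0) : p = Submodule.span k {x} := by
  have := Module.finite_of_finrank_eq_succ hp
  refine (Submodule.eq_of_le_of_finrank_eq ?_ ?_).symm
  · rwa [Submodule.span_singleton_le_iff_mem]
  · rw [hp, finrank_span_singleton h0]

end Indep

section Matrix

variable {k : Type*} [Field k] {Q : Type*} [AddCommGroup Q] [Module k Q]

/-- The linear map sending the standard matrix units of `Mat₂(k)` to `a`, `x`, `y`, `b`. -/
def ofMatrixUnits (a x y b : Q) : Matrix (Fin 2) (Fin 2) k →ₗ[k] Q where
  toFun M := M 0 0 • a + M 0 1 • x + M 1 0 • y + M 1 1 • b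
  map_add' M N := by simp only [Matrix.add_apply]; module
  map_smul' c M := by simp only [Matrix.smul_apply, smul_eq_mul, RingHom.id_apply]; module

theorem ofMatrixUnits_apply (a x y b : Q) (M : Matrix (Fin 2) (Fin 2) k) :
    ofMatrixUnits a x y b M = M 0 0 • a + M 0 1 • x + M 1 0 • y + M 1 1 • b := rfl

end Matrix

section Graded

variable {k : Type*} [Field k] {Q : Type*} [AddCommGroup Q] [Module k Q]
  {mul : Q →ₗ[k] Q →ₗ[k] Q} {n : QuadraticForm k Q} {e : Q}
  {G : Type*} [Group G] {A : G → Submodule k Q}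

theorem one_mem (hle : ∀ x : Q, mul e x = x) (hre : ∀ x : Q, mul x e = x)
    (hA : iSupIndep A) (htop : ⨆ g, A g = ⊤)
    (hgrmul : ∀ g h : G, ∀ x ∈ A g, ∀ y ∈ A h, mul x y ∈ A (g * h)) : e ∈ A 1 := by
  have hsup : A 1 ⊔ ⨆ (j) (_ : j ≠ 1), A j = ⊤ := by
    refine top_le_iff.1 (htop ▸ iSup_le fun j => ?_)
    by_cases hj : j = 1
    · exact hj ▸ le_sup_left
    · exact le_sup_of_le_right (le_iSup₂_of_le j hj le_rfl)
  obtain ⟨u, hu, r, hr, hur⟩ := Submodule.mem_sup.1 (hsup ▸ Submodule.mem_top : e ∈ _)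
  have key : ∀ h, A h ≤ LinearMap.ker (mul.flip r) := fun h x hx => by
    have h1 : (⨆ (j) (_ : j ≠ 1), A j) ≤ (⨆ (j) (_ : j ≠ h), A j).comap (mul x) :=
      iSup₂_le fun j hj y hy => Submodule.mem_iSup_of_mem (h * j)
        (Submodule.mem_iSup_of_mem (by simpa using hj) (hgrmul h j x hx y hy))
    have h2 : mul x r ∈ A h := by
      have : mul x r = x - mul x u := by
        rw [eq_sub_iff_add_eq', ← map_add, hur, hre]
      rw [this]
      exact sub_mem hx (by simpa using hgrmul h 1 x hx u hu)
    exact Submodule.disjoint_def.1 (hA h) _ h2 (h1 hr)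
  have hr0 : r = 0 := by
    have : e ∈ LinearMap.ker (mul.flip r) := (iSup_le key) (htop ▸ Submodule.mem_top)
    simpa [hle] using this
  rwa [← hur, hr0, add_zero]

variable (hnondeg : ∀ x : Q, (∀ y : Q, polar n x y = 0) → x = 0)
  (hcomp : ∀ x y : Q, n (mul x y) = n x * n y)
  (hle : ∀ x : Q, mul e x = x) (hre : ∀ x : Q, mul x e = x)
  (hA : iSupIndep A) (htop : ⨆ g, A g = ⊤) (he : e ∈ A 1) (he0 : e ≠ 0)
  (hgrmul : ∀ g h : G, ∀ x ∈ A g, ∀ y ∈ A h, mul x y ∈ A (g * h))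

include hnondeg hcomp hle hre hA he hgrmul in
theorem polar_one_eq_zero {g : G} (hg : g ≠ 1) {x : Q} (hx : x ∈ A g) : polar n x e = 0 := by
  by_cases hx0 : x = 0
  · simp [hx0]
  have h := mul_self_eq hnondeg hcomp hle hre x
  have := eq_zero_of_eq_add hA (g := g) (a := g * g) (b := 1) (by simpa using hg) hg.symm
    ((A g).smul_mem (polar n x e) hx) (hgrmul g g x hx x hx) ((A 1).smul_mem (n x) he)
    (by rw [h]; abel)
  exact (smul_eq_zero.1 this).resolve_right hx0

include hnondeg hcomp hle hre hA he he0 hgrmul in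
theorem map_eq_zero_of_mul_self_ne_one {g : G} (hg : g * g ≠ 1) {x : Q} (hx : x ∈ A g) :
    n x = 0 := by
  have h := mul_self_eq hnondeg hcomp hle hre x
  rw [polar_one_eq_zero hnondeg hcomp hle hre hA he hgrmul (by rintro rfl; simp at hg) hx,
    zero_smul, zero_sub] at h
  have := eq_zero_of_eq_add hA (g := 1) hg hg ((A 1).smul_mem (n x) he)
    ((A _).neg_mem (hgrmul g g x hx x hx)) (A _).zero_mem (by rw [h]; simp)
  exact (smul_eq_zero.1 this).resolve_right he0

include hnondeg hcomp hle hre hA he he0 hgrmul in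
theorem polar_eq_zero_of_mul_ne_one {g h : G} (hgh : g * h ≠ 1) {x y : Q} (hx : x ∈ A g)
    (hy : y ∈ A h) : polar n x y = 0 := by
  have hhg : h * g ≠ 1 := fun H => hgh (mul_eq_one_comm.1 H)
  have key := polar_smul_one_eq hnondeg hcomp hle hre x y
  have h1 : ∀ {g : G}, g ≠ 1 → ∀ {x : Q}, x ∈ A g → polar n x e = 0 :=
    fun hg _ hx => polar_one_eq_zero hnondeg hcomp hle hre hA he hgrmul hg hx
  have hxy := hgrmul g h x hx y hy
  have hyx := hgrmul h g y hy x hx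
  have hs1 : polar n x e • y ∈ A (g * h) := by
    by_cases hg : g = 1
    · simpa [hg] using (A h).smul_mem _ hy
    · simp [h1 hg hx]
  have hs2 : polar n y e • x ∈ A (h * g) := by
    by_cases hh : h = 1
    · simpa [hh] using (A g).smul_mem _ hx
    · simp [h1 hh hy]
  have := eq_zero_of_eq_add hA (g := 1) hgh hhg ((A 1).smul_mem (polar n x y) he)
    (sub_mem hs1 hxy) (sub_mem hs2 hyx) (by rw [key]; abel)
  exact (smul_eq_zero.1 this).resolve_right he0

include hnondeg hcomp hle hre hA htop he he0 hgrmul in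
theorem exists_polar_ne_zero {g : G} {x : Q} (hx : x ∈ A g) (hx0 : x ≠ 0) :
    ∃ y ∈ A g⁻¹, polar n x y ≠ 0 := by
  by_contra! H
  refine hx0 (hnondeg x fun y => ?_)
  have : ⨆ h, A h ≤ LinearMap.ker (n.polarBilin x) := iSup_le fun h z hz => by
    by_cases hh : h = g⁻¹
    · exact H z (hh ▸ hz)
    · exact polar_eq_zero_of_mul_ne_one hnondeg hcomp hle hre hA he he0 hgrmul
        (fun h' => hh (eq_inv_of_mul_eq_one_right h')) hx hz
  exact this (htop ▸ Submodule.mem_top)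

include hnondeg hcomp hle hre hA htop he he0 hgrmul in
theorem exists_map_ne_zero {g : G} (hg : g * g = 1) (hbot : A g ≠ ⊥) :
    ∃ x ∈ A g, n x ≠ 0 := by
  obtain ⟨x, hx, hx0⟩ := Submodule.exists_mem_ne_zero_of_ne_bot hbot
  obtain ⟨y, hy, hxy⟩ :=
    exists_polar_ne_zero hnondeg hcomp hle hre hA htop he he0 hgrmul hx hx0
  rw [← eq_inv_of_mul_eq_one_left hg] at hy
  by_contra! H
  exact hxy (by simp [polar, H _ hx, H _ hy, H _ (add_mem hx hy)])

include hnondeg hcomp hle hgrmul in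
theorem finrank_le_finrank_mul [FiniteDimensional k Q] {g : G} (h : G) {x : Q} (hx : x ∈ A g)
    (hn : n x ≠ 0) : Module.finrank k (A h) ≤ Module.finrank k (A (g * h)) :=
  LinearMap.finrank_le_finrank_of_injective
    (f := (mul x).restrict fun y hy => hgrmul g h x hx y hy) fun _ _ hab =>
      Subtype.ext (mul_left_injective_of_map_ne_zero hnondeg hcomp hle hn
        (congrArg Subtype.val hab))

include hnondeg hcomp hle hre hA htop he he0 hgrmul in
theorem finrank_eq_of_mul_self_eq_one [FiniteDimensional k Q] {g : G} (hg : g * g = 1)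
    (hbot : A g ≠ ⊥) : Module.finrank k (A g) = Module.finrank k (A 1) := by
  obtain ⟨x, hx, hn⟩ :=
    exists_map_ne_zero hnondeg hcomp hle hre hA htop he he0 hgrmul hg hbot
  have h1 := finrank_le_finrank_mul hnondeg hcomp hle hgrmul g hx hn
  have h2 := finrank_le_finrank_mul hnondeg hcomp hle hgrmul 1 hx hn
  rw [hg] at h1
  rw [mul_one] at h2
  exact le_antisymm h1 h2

include hnondeg hcomp hle hre hA htop he he0 hgrmul in
theorem exists_dual_pair {g : G} (hg : g * g ≠ 1) (hbot : A g ≠ ⊥) :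
    ∃ x ∈ A g, ∃ y ∈ A g⁻¹, n x = 0 ∧ n y = 0 ∧ polar n x e = 0 ∧ polar n y e = 0 ∧
      mul x y + mul y x = e ∧ polar n (mul x y) e = 1 := by
  have hg1 : g ≠ 1 := by rintro rfl; simp at hg
  have hg' : g⁻¹ * g⁻¹ ≠ 1 := fun h => hg (by
    rw [← inv_inj, mul_inv_rev, h, inv_one])
  obtain ⟨x, hx, hx0⟩ := Submodule.exists_mem_ne_zero_of_ne_bot hbot
  obtain ⟨z, hz, hxz⟩ :=
    exists_polar_ne_zero hnondeg hcomp hle hre hA htop he he0 hgrmul hx hx0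
  set y := -(polar n x z)⁻¹ • z with hy
  have hyA : y ∈ A g⁻¹ := (A _).smul_mem _ hz
  have hxy : polar n x y = -1 := by
    rw [hy, polar_smul_right, smul_eq_mul, neg_mul, inv_mul_cancel₀ hxz]
  have htx := polar_one_eq_zero hnondeg hcomp hle hre hA he hgrmul hg1 hx
  have hty := polar_one_eq_zero hnondeg hcomp hle hre hA he hgrmul (inv_ne_one.2 hg1) hyA
  refine ⟨x, hx, y, hyA,
    map_eq_zero_of_mul_self_ne_one hnondeg hcomp hle hre hA he he0 hgrmul hg hx,
    map_eq_zero_of_mul_self_ne_one hnondeg hcomp hle hre hA he he0 hgrmul hg' hyA,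
    htx, hty, ?_, ?_⟩
  · have h := polar_smul_one_eq hnondeg hcomp hle hre x y
    rw [hxy, htx, hty, zero_smul, zero_smul, add_zero, zero_sub, neg_smul, one_smul] at h
    exact (neg_injective h).symm
  · have h := polar_mul_mul_add hcomp x y e e
    rw [hle, hle, hre, htx, zero_mul, polar_comm n y x, hxy] at h
    linear_combination h

include hnondeg hcomp hle hre hA hgrmul in
theorem exists_matrix_equiv (hdim : Module.finrank k Q = 4) {g : G} (hg : g * g ≠ 1) {x y : Q}
    (hx : x ∈ A g) (hy : y ∈ A g⁻¹) (hnx : n x = 0) (hny : n y = 0)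
    (htx : polar n x e = 0) (hty : polar n y e = 0) (hsum : mul x y + mul y x = e)
    (htxy : polar n (mul x y) e = 1) :
    ∃ φ : Q ≃ₗ[k] Matrix (Fin 2) (Fin 2) k,
      (∀ a b : Q, φ (mul a b) = φ a * φ b) ∧
      (∀ q, q ∈ A 1 ↔ φ q 0 1 = 0 ∧ φ q 1 0 = 0) ∧
      (∀ q, q ∈ A g ↔ φ q 0 0 = 0 ∧ φ q 1 0 = 0 ∧ φ q 1 1 = 0) ∧
      (∀ q, q ∈ A g⁻¹ ↔ φ q 0 0 = 0 ∧ φ q 0 1 = 0 ∧ φ q 1 1 = 0) := by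
  have hfd : FiniteDimensional k Q := Module.finite_of_finrank_pos (by omega)
  have hg1 : g ≠ 1 := by rintro rfl; simp at hg
  have hgi : g⁻¹ ≠ g := fun h => hg (by nth_rw 1 [← h]; simp)
  have hgi1 : g⁻¹ ≠ 1 := inv_ne_one.2 hg1
  obtain ⟨a, ha⟩ : ∃ a, mul x y = a := ⟨_, rfl⟩
  obtain ⟨b, hb⟩ : ∃ b, mul y x = b := ⟨_, rfl⟩
  have hae : b = e - a := by rw [← hsum, ha, hb]; abel
  have haA : a ∈ A 1 := by simpa [ha] using hgrmul g g⁻¹ x hx y hy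
  have hbA : b ∈ A 1 := by simpa [hb] using hgrmul g⁻¹ g y hy x hx
  have hxx : mul x x = 0 := by rw [mul_self_eq hnondeg hcomp hle hre, htx, hnx]; simp
  have hyy : mul y y = 0 := by rw [mul_self_eq hnondeg hcomp hle hre, hty, hny]; simp
  have hxa : mul x a = 0 := by rw [← ha, mul_mul_self_left hnondeg hcomp hle, htx, hnx]; simp
  have hyb : mul y b = 0 := by rw [← hb, mul_mul_self_left hnondeg hcomp hle, hty, hny]; simp
  have hay : mul a y = 0 := by rw [← ha, mul_mul_self_right hnondeg hcomp hre, hty, hny]; simp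
  have hbx : mul b x = 0 := by rw [← hb, mul_mul_self_right hnondeg hcomp hre, htx, hnx]; simp
  have hxb : mul x b = x := by rw [hae, map_sub, hxa, hre, sub_zero]
  have hya : mul y a = y := by
    rw [show a = e - b by rw [hae]; abel, map_sub, hyb, hre, sub_zero]
  have hby : mul b y = y := by rw [hae, map_sub, LinearMap.sub_apply, hay, hle, sub_zero]
  have hax : mul a x = x := by
    rw [show a = e - b by rw [hae]; abel, map_sub, LinearMap.sub_apply, hbx, hle, sub_zero]
  have haa : mul a a = a := by
    rw [mul_self_eq hnondeg hcomp hle hre, ← ha, htxy, hcomp, hnx]; simp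
  have hab : mul a b = 0 := by rw [hae, map_sub, hre, haa, sub_self]
  have hba : mul b a = 0 := by rw [hae, map_sub, LinearMap.sub_apply, hle, haa, sub_self]
  have hbb : mul b b = b := by nth_rw 2 [hae]; rw [map_sub, hre, hba, sub_zero]
  have ha0 : a ≠ 0 := by rintro rfl; simp [ha] at htxy
  have hx0 : x ≠ 0 := by rintro rfl; exact ha0 (by simp [← ha])
  have hy0 : y ≠ 0 := by rintro rfl; exact ha0 (by simp [← ha])
  have hb0 : b ≠ 0 := by rintro rfl; exact hx0 (by rw [← hxb, map_zero])
  have hψmul : ∀ M N : Matrix (Fin 2) (Fin 2) k,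
      ofMatrixUnits a x y b (M * N) =
        mul (ofMatrixUnits a x y b M) (ofMatrixUnits a x y b N) := fun M N => by
    simp only [ofMatrixUnits_apply, Matrix.mul_apply, Fin.sum_univ_two, map_add, map_smul,
      LinearMap.add_apply, LinearMap.smul_apply, ha, hb, hxx, hyy, hxa, hyb, hay, hbx, hxb, hya,
      hby, hax, haa, hab, hba, hbb, smul_zero, add_zero, zero_add]
    module
  have hker : ∀ M : Matrix (Fin 2) (Fin 2) k, ∀ q ∈ A 1, ∀ r ∈ A g, ∀ s ∈ A g⁻¹,
      ofMatrixUnits a x y b M = q + r + s →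
        M 0 0 • a + M 1 1 • b = q ∧ M 0 1 • x = r ∧ M 1 0 • y = s := by
    intro M q hq r hr s hs h
    rw [ofMatrixUnits_apply] at h
    have h1 : M 0 0 • a + M 1 1 • b - q ∈ A 1 :=
      sub_mem (add_mem ((A 1).smul_mem _ haA) ((A 1).smul_mem _ hbA)) hq
    have h2 : M 0 1 • x - r ∈ A g := sub_mem ((A g).smul_mem _ hx) hr
    have h3 : M 1 0 • y - s ∈ A g⁻¹ := sub_mem ((A _).smul_mem _ hy) hs
    refine ⟨sub_eq_zero.1 (eq_zero_of_eq_add hA hg1 hgi1 h1 (neg_mem h2) (neg_mem h3) ?_),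
      sub_eq_zero.1 (eq_zero_of_eq_add hA hg1.symm hgi h2 (neg_mem h1) (neg_mem h3) ?_),
      sub_eq_zero.1 (eq_zero_of_eq_add hA hgi1.symm hgi.symm h3 (neg_mem h1) (neg_mem h2) ?_)⟩ <;>
    linear_combination (norm := module) (1 : k) • h
  have hdiag : ∀ c d : k, c • a + d • b = 0 → c = 0 ∧ d = 0 := fun c d h => by
    have h1 := congrArg (mul a) h
    have h2 := congrArg (mul b) h
    simp only [map_add, map_smul, haa, hab, hba, hbb, smul_zero, add_zero, zero_add,
      map_zero] at h1 h2
    exact ⟨(smul_eq_zero.1 h1).resolve_right ha0, (smul_eq_zero.1 h2).resolve_right hb0⟩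
  have hinj : Function.Injective (ofMatrixUnits (k := k) a x y b) := by
    refine (injective_iff_map_eq_zero _).2 fun M hM => ?_
    obtain ⟨h1, h2, h3⟩ := hker M 0 (zero_mem _) 0 (zero_mem _) 0 (zero_mem _) (by simpa using hM)
    obtain ⟨h4, h5⟩ := hdiag _ _ h1
    ext i j
    fin_cases i <;> fin_cases j
    exacts [h4, (smul_eq_zero.1 h2).resolve_right hx0, (smul_eq_zero.1 h3).resolve_right hy0, h5]
  let ψ := LinearEquiv.ofInjectiveOfFinrankEq (ofMatrixUnits (k := k) a x y b) hinj
    (by rw [hdim, Module.finrank_matrix]; simp)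
  have hψ : ∀ M, ψ M = ofMatrixUnits a x y b M := fun M => rfl
  refine ⟨ψ.symm, fun p q => ?_, fun q => ?_, fun q => ?_, fun q => ?_⟩
  · rw [LinearEquiv.symm_apply_eq, hψ, hψmul, ← hψ, ← hψ, ψ.apply_symm_apply,
      ψ.apply_symm_apply]
  all_goals
    obtain ⟨M, rfl⟩ := ψ.surjective q
    rw [ψ.symm_apply_apply, hψ]
  · constructor
    · intro h
      obtain ⟨-, h2, h3⟩ := hker M _ h 0 (zero_mem _) 0 (zero_mem _) (by simp)
      exact ⟨(smul_eq_zero.1 h2).resolve_right hx0, (smul_eq_zero.1 h3).resolve_right hy0⟩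
    · rintro ⟨h1, h2⟩
      rw [ofMatrixUnits_apply, h1, h2, zero_smul, zero_smul, add_zero, add_zero]
      exact add_mem ((A 1).smul_mem _ haA) ((A 1).smul_mem _ hbA)
  · constructor
    · intro h
      obtain ⟨h1, -, h3⟩ := hker M 0 (zero_mem _) _ h 0 (zero_mem _) (by simp)
      exact ⟨(hdiag _ _ h1).1, (smul_eq_zero.1 h3).resolve_right hy0, (hdiag _ _ h1).2⟩
    · rintro ⟨h1, h2, h3⟩
      rw [ofMatrixUnits_apply, h1, h2, h3]
      simpa using (A g).smul_mem (M 0 1) hx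
  · constructor
    · intro h
      obtain ⟨h1, h2, -⟩ := hker M 0 (zero_mem _) 0 (zero_mem _) _ h (by simp)
      exact ⟨(hdiag _ _ h1).1, (smul_eq_zero.1 h2).resolve_right hx0, (hdiag _ _ h1).2⟩
    · rintro ⟨h1, h2, h3⟩
      rw [ofMatrixUnits_apply, h1, h2, h3]
      simpa using (A g⁻¹).smul_mem (M 1 0) hy

include hnondeg hcomp hle hre hA htop he he0 hgrmul in
theorem mem_iff_forall_polar_eq_zero {g : G} (hg1 : g ≠ 1) (hsupp : A 1 ⊔ A g = ⊤) (z : Q) :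
    z ∈ A g ↔ ∀ w ∈ A 1, polar n z w = 0 := by
  refine ⟨fun hz w hw => polar_eq_zero_of_mul_ne_one hnondeg hcomp hle hre hA he he0 hgrmul
    (by simpa using hg1) hz hw, fun hz => ?_⟩
  obtain ⟨u, hu, v, hv, rfl⟩ := Submodule.mem_sup.1 (hsupp ▸ Submodule.mem_top : z ∈ A 1 ⊔ A g)
  have hu0 : u = 0 := by
    by_contra hu0
    obtain ⟨w, hw, huw⟩ :=
      exists_polar_ne_zero hnondeg hcomp hle hre hA htop he he0 hgrmul hu hu0
    rw [inv_one] at hw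
    have h := hz w hw
    rw [polar_add_left, polar_eq_zero_of_mul_ne_one hnondeg hcomp hle hre hA he he0 hgrmul
      (by simpa using hg1) hv hw, add_zero] at h
    exact huw h
  rwa [hu0, zero_add]

end Graded

end HurwitzGrading

open HurwitzGrading

/-- classification of the nontrivial group gradings of a
quaternion algebra `(Q,·,n)` (a four-dimensional Hurwitz algebra): either
(1) a ℤ₂-grading with identity component a two-dimensional composition
subalgebra and the other component its orthogonal complement; or (2) char k ≠ 2
and a ℤ₂ × ℤ₂-grading coming from the iterated Cayley–Dickson process; or (3)
a 3-grading making `Q` isomorphic to `Mat₂(k)` with the induced grading by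
diagonal, strictly upper and strictly lower triangular matrices. -/
theorem quaternion_gradings_classification
    {k : Type*} [Field k] {Q : Type*} [AddCommGroup Q] [Module k Q]
    (mul : Q →ₗ[k] Q →ₗ[k] Q) (n : QuadraticForm k Q)
    (hnondeg : ∀ x : Q, (∀ y : Q, polar n x y = 0) → x = 0)
    (hcomp : ∀ x y : Q, n (mul x y) = n x * n y)
    (e : Q) (hle : ∀ x : Q, mul e x = x) (hre : ∀ x : Q, mul x e = x)
    (hdim : Module.finrank k Q = 4)
    {G : Type*} [Group G] [DecidableEq G]
    (A : G → Submodule k Q)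
    (hdecomp : DirectSum.IsInternal A)
    (hgrmul : ∀ g h : G, ∀ x ∈ A g, ∀ y ∈ A h, mul x y ∈ A (g * h))
    (hnontriv : A 1 ≠ ⊤) :
    -- (1) ℤ₂-grading: Cayley–Dickson doubling
    (∃ g : G, g ≠ 1 ∧ g ^ 2 = 1 ∧
      {h : G | A h ≠ ⊥} = {1, g} ∧
      e ∈ A 1 ∧ Module.finrank k (A 1) = 2 ∧
      (∀ a ∈ A 1, ∀ b ∈ A 1, mul a b ∈ A 1) ∧
      (∀ a ∈ A 1, (∀ b ∈ A 1, polar n a b = 0) → a = 0) ∧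
      (∀ z : Q, z ∈ A g ↔ ∀ w ∈ A 1, polar n z w = 0)) ∨
    -- (2) ℤ₂ × ℤ₂-grading (char k ≠ 2)
    (ringChar k ≠ 2 ∧
      ∃ g h : G, g ≠ 1 ∧ h ≠ 1 ∧ g ≠ h ∧ g ^ 2 = 1 ∧ h ^ 2 = 1 ∧ g * h = h * g ∧
        {u : G | A u ≠ ⊥} = {1, g, h, g * h} ∧
        A 1 = Submodule.span k {e} ∧
        ∃ x y : Q, n x ≠ 0 ∧ n y ≠ 0 ∧
          polar n e x = 0 ∧ polar n e y = 0 ∧ polar n x y = 0 ∧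
          A g = Submodule.span k {x} ∧ A h = Submodule.span k {y} ∧
          A (g * h) = Submodule.span k {mul x y}) ∨
    -- (3) 3-grading: Q ≅ Mat₂(k)
    (∃ g : G, g ≠ g⁻¹ ∧
      {h : G | A h ≠ ⊥} = {1, g, g⁻¹} ∧
      Module.finrank k (A 1) = 2 ∧
      Module.finrank k (A g) = 1 ∧ Module.finrank k (A g⁻¹) = 1 ∧
      ∃ φ : Q ≃ₗ[k] Matrix (Fin 2) (Fin 2) k,
        (∀ a b : Q, φ (mul a b) = φ a * φ b) ∧
        (⇑φ '' (A 1 : Set Q) =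
          {M : Matrix (Fin 2) (Fin 2) k | ∀ i j : Fin 2, i ≠ j → M i j = 0}) ∧
        (⇑φ '' (A g : Set Q) =
          {M : Matrix (Fin 2) (Fin 2) k | ∀ i j : Fin 2, ¬ i < j → M i j = 0}) ∧
        (⇑φ '' (A g⁻¹ : Set Q) =
          {M : Matrix (Fin 2) (Fin 2) k | ∀ i j : Fin 2, ¬ j < i → M i j = 0})) := by
  have hA : iSupIndep A := hdecomp.submodule_iSupIndep
  have htop : ⨆ g, A g = ⊤ := hdecomp.submodule_iSup_eq_top
  have hfd : FiniteDimensional k Q := Module.finite_of_finrank_pos (by omega)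
  have hnt : Nontrivial Q := Module.nontrivial_of_finrank_pos (R := k) (by omega)
  have he : e ∈ A 1 := one_mem hle hre hA htop hgrmul
  have hn1 : n e = 1 := map_one_eq_one hnondeg hcomp hle
  have he0 : e ≠ 0 := by rintro rfl; simp at hn1
  have hbot1 : A 1 ≠ ⊥ := (Submodule.ne_bot_iff _).2 ⟨e, he, he0⟩
  have hpos : ∀ {h : G}, A h ≠ ⊥ → 0 < Module.finrank k (A h) := fun hh =>
    Nat.pos_of_ne_zero fun h0 => hh (Submodule.finrank_eq_zero.1 h0)
  have hinv : ∀ {h : G}, A h ≠ ⊥ → A h⁻¹ ≠ ⊥ := fun hh hh' => by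
    obtain ⟨x, hx, hx0⟩ := Submodule.exists_mem_ne_zero_of_ne_bot hh
    obtain ⟨y, hy, hxy⟩ :=
      exists_polar_ne_zero hnondeg hcomp hle hre hA htop he he0 hgrmul hx hx0
    rw [hh', Submodule.mem_bot] at hy
    exact hxy (by rw [hy, polar_zero_right])
  have horth : ∀ {g h : G}, g * h ≠ 1 → ∀ {x y : Q}, x ∈ A g → y ∈ A h → polar n x y = 0 :=
    fun hgh _ _ hx hy =>
      polar_eq_zero_of_mul_ne_one hnondeg hcomp hle hre hA he he0 hgrmul hgh hx hy
  by_cases hsq : ∃ g, A g ≠ ⊥ ∧ g * g ≠ 1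
  · right; right
    obtain ⟨g, hgb, hg⟩ := hsq
    have hg1 : g ≠ 1 := by rintro rfl; simp at hg
    have hgi : g ≠ g⁻¹ := fun h => hg (by nth_rw 1 [h]; simp)
    obtain ⟨x, hx, y, hy, hnx, hny, htx, hty, hsum, htxy⟩ :=
      exists_dual_pair hnondeg hcomp hle hre hA htop he he0 hgrmul hg hgb
    have hnotone : Module.finrank k (A 1) ≠ 1 := fun h1 => by
      have hxy : mul x y ∈ A 1 := by simpa using hgrmul g g⁻¹ x hx y hy
      rw [eq_span_of_finrank_eq_one h1 he he0, Submodule.mem_span_singleton] at hxy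
      obtain ⟨c, hc⟩ := hxy
      have hnc := hcomp x y
      rw [← hc, QuadraticMap.map_smul, hn1, hnx, zero_mul, smul_eq_mul, mul_one,
        mul_self_eq_zero] at hnc
      rw [← hc, hnc, zero_smul, polar_zero_left] at htxy
      exact zero_ne_one htxy
    have hsumeq : ∑ i ∈ ({1, g, g⁻¹} : Finset G), Module.finrank k (A i) =
        Module.finrank k (A 1) + (Module.finrank k (A g) + Module.finrank k (A g⁻¹)) := by
      rw [Finset.sum_insert, Finset.sum_insert, Finset.sum_singleton]
      · simpa using hgi
      · simpa using ⟨hg1.symm, hg1⟩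
    have hle4 := sum_finrank_le hA {1, g, g⁻¹}
    have p1 := hpos hbot1
    have p2 := hpos hgb
    have p3 := hpos (hinv hgb)
    have hsupp := support_eq_of_sum_finrank_eq hA (s := {1, g, g⁻¹}) (by omega) (by
      simpa using ⟨hbot1, hgb, hinv hgb⟩)
    obtain ⟨φ, hφ, h1, h2, h3⟩ := exists_matrix_equiv hnondeg hcomp hle hre hA hgrmul
      hdim hg hx hy hnx hny htx hty hsum htxy
    refine ⟨g, hgi, by simpa using hsupp, by omega, by omega, by omega, φ, hφ, ?_, ?_, ?_⟩ <;>
    · ext M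
      obtain ⟨q, rfl⟩ := φ.surjective M
      rw [φ.injective.mem_set_image, SetLike.mem_coe]
      simp [h1, h2, h3, Fin.forall_fin_two, and_assoc]
  push Not at hsq
  obtain ⟨g, hg1, hgb⟩ : ∃ g, g ≠ 1 ∧ A g ≠ ⊥ := by
    by_contra! H
    refine hnontriv (top_le_iff.1 (htop ▸ iSup_le fun h => ?_))
    by_cases hh : h = 1
    · rw [hh]
    · rw [H h hh]; exact bot_le
  have hgg := hsq g hgb
  have hfr : ∀ {h : G}, A h ≠ ⊥ → Module.finrank k (A h) = Module.finrank k (A 1) :=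
    fun hh => finrank_eq_of_mul_self_eq_one hnondeg hcomp hle hre hA htop he he0 hgrmul
      (hsq _ hh) hh
  have p1 := hpos hbot1
  have hsum2 : ∑ i ∈ ({1, g} : Finset G), Module.finrank k (A i) =
      Module.finrank k (A 1) + Module.finrank k (A g) := by
    rw [Finset.sum_insert (by simpa using hg1.symm), Finset.sum_singleton]
  have hle2 := sum_finrank_le hA {1, g}
  have hgfr := hfr hgb
  by_cases hd : Module.finrank k (A 1) = 2
  · left
    have hsupp := support_eq_of_sum_finrank_eq hA (s := {1, g}) (by omega) (by
      simpa using ⟨hbot1, hgb⟩)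
    have hsup : A 1 ⊔ A g = ⊤ := by
      refine Submodule.eq_top_of_finrank_eq ?_
      have h := finrank_sup_eq_sum hA {1, g}
      rw [Finset.sup_insert, Finset.sup_singleton] at h
      omega
    refine ⟨g, hg1, by rw [pow_two, hgg], by simpa using hsupp, he, hd,
      fun a ha b hb => by simpa using hgrmul 1 1 a ha b hb, fun a ha hab => ?_,
      mem_iff_forall_polar_eq_zero hnondeg hcomp hle hre hA htop he he0 hgrmul hg1 hsup⟩
    by_contra ha0
    obtain ⟨y, hy, hay⟩ :=
      exists_polar_ne_zero hnondeg hcomp hle hre hA htop he he0 hgrmul ha ha0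
    exact hay (hab y (by simpa using hy))
  · right; left
    have hd1 : Module.finrank k (A 1) = 1 := by omega
    have hspan1 := eq_span_of_finrank_eq_one hd1 he he0
    refine ⟨fun hchar => ?_, ?_⟩
    · have h2 : (2 : k) = 0 := by
        have := ringChar.Nat.cast_ringChar (R := k)
        rw [hchar] at this
        exact_mod_cast this
      obtain ⟨y, hy, hey⟩ :=
        exists_polar_ne_zero hnondeg hcomp hle hre hA htop he he0 hgrmul he he0
      rw [inv_one, hspan1, Submodule.mem_span_singleton] at hy
      obtain ⟨c, rfl⟩ := hy
      rw [polar_smul_right, polar_self, two_smul, ← two_mul, h2, zero_mul,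
        smul_zero] at hey
      exact hey rfl
    obtain ⟨h, hh1, hhg, hhb⟩ : ∃ h, h ≠ 1 ∧ h ≠ g ∧ A h ≠ ⊥ := by
      by_contra! H
      have h2 : A 1 ⊔ A g = ⊤ := by
        refine top_le_iff.1 (htop ▸ iSup_le fun h => ?_)
        by_cases hh : h = 1
        · exact hh ▸ le_sup_left
        by_cases hh' : h = g
        · exact hh' ▸ le_sup_right
        · rw [H h hh hh']; exact bot_le
      have h3 := finrank_sup_eq_sum hA {1, g}
      rw [Finset.sup_insert, Finset.sup_singleton, h2, finrank_top] at h3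
      omega
    have hhh := hsq h hhb
    obtain ⟨x, hx, hnx⟩ :=
      exists_map_ne_zero hnondeg hcomp hle hre hA htop he he0 hgrmul hgg hgb
    obtain ⟨y, hy, hny⟩ :=
      exists_map_ne_zero hnondeg hcomp hle hre hA htop he he0 hgrmul hhh hhb
    have hxy := hgrmul g h x hx y hy
    have hnxy : n (mul x y) ≠ 0 := by rw [hcomp]; exact mul_ne_zero hnx hny
    have hne0 : ∀ {z : Q}, n z ≠ 0 → z ≠ 0 := fun hz h0 => hz (by rw [h0, map_zero])
    have hghb : A (g * h) ≠ ⊥ := (Submodule.ne_bot_iff _).2 ⟨_, hxy, hne0 hnxy⟩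
    have hgh1 : g * h ≠ 1 := fun H =>
      hhg ((eq_inv_of_mul_eq_one_right H).trans (eq_inv_of_mul_eq_one_left hgg).symm)
    have hgh2 := hsq _ hghb
    have hcomm : g * h = h * g := by
      rw [eq_inv_of_mul_eq_one_left hgh2, mul_inv_rev, ← eq_inv_of_mul_eq_one_left hgg,
        ← eq_inv_of_mul_eq_one_left hhh]
    have f1 := hfr hhb
    have f2 := hfr hghb
    have hsumeq : ∑ i ∈ ({1, g, h, g * h} : Finset G), Module.finrank k (A i) =
        Module.finrank k Q := by
      rw [Finset.sum_insert, Finset.sum_insert, Finset.sum_insert, Finset.sum_singleton]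
      · omega
      · simpa using hg1
      · simpa using ⟨hhg.symm, hh1⟩
      · simpa using ⟨hg1.symm, hh1.symm, hgh1.symm⟩
    have hsupp := support_eq_of_sum_finrank_eq hA hsumeq (by
      simpa using ⟨hbot1, hgb, hhb, hghb⟩)
    exact ⟨g, h, hg1, hh1, hhg.symm, by rw [pow_two, hgg], by rw [pow_two, hhh], hcomm,
      by simpa using hsupp, hspan1, x, y, hnx, hny, horth (by simpa using hg1) he hx,
      horth (by simpa using hh1) he hy, horth hgh1 hx hy,
      eq_span_of_finrank_eq_one (hgfr.trans hd1) hx (hne0 hnx),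
      eq_span_of_finrank_eq_one (f1.trans hd1) hy (hne0 hny),
      eq_span_of_finrank_eq_one (f2.trans hd1) hxy (hne0 hnxy)⟩
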